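/- Normal form at a regular transversal point of the Martinet curve (the case L = (x₁²/2)ẋ₂ ∓ x₂ of Theorem 5 on singular Lagrangians): let ω = u dx∧dy be a real-analytic 2-form germ at 0 ∈ ℝ² with u = x·c where c is real-analytic and c(0,0) ≠ 0 (a Martinet germ with Martinet curve {x = 0}), and let f be real-analytic near 0 with f(0,0) = 0 and ∂f/∂y(0,0) ≠ 0 (so the restriction of f to the Martinet curve is regular at 0). Then there exist ε ∈ {−1, +1} and a real-analytic diffeomorphism germ Φ at 0 with Φ(0) = 0 such that (u∘Φ)·det(DΦ) = x and f∘Φ(x,y) = ε·y near 0. -/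

import Mathlib

open Filter Topology

/-- The partial derivative with respect to the first variable. -/
noncomputable def pdx (f : ℝ × ℝ → ℝ) (z : ℝ × ℝ) : ℝ := fderiv ℝ f z (1, 0)

/-- The partial derivative with respect to the second variable. -/
noncomputable def pdy (f : ℝ × ℝ → ℝ) (z : ℝ × ℝ) : ℝ := fderiv ℝ f z (0, 1)

/-- The Jacobian determinant of a map `Φ : ℝ² → ℝ²`. -/
noncomputable def jacDet (Φ : ℝ × ℝ → ℝ × ℝ) (z : ℝ × ℝ) : ℝ :=
  pdx (fun w => (Φ w).1) z * pdy (fun w => (Φ w).2) z -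
    pdy (fun w => (Φ w).1) z * pdx (fun w => (Φ w).2) z

/-- A germ of real-analytic diffeomorphism at `0 ∈ ℝ²` fixing `0`:
a real-analytic map with a real-analytic local inverse near `0`. -/
def IsAnalyticDiffeoGermAtZero (Φ : ℝ × ℝ → ℝ × ℝ) : Prop :=
  AnalyticAt ℝ Φ 0 ∧ Φ 0 = 0 ∧
    ∃ Ψ : ℝ × ℝ → ℝ × ℝ, AnalyticAt ℝ Ψ 0 ∧ Ψ 0 = 0 ∧
      (∀ᶠ z in 𝓝 (0 : ℝ × ℝ), Ψ (Φ z) = z) ∧ (∀ᶠ z in 𝓝 (0 : ℝ × ℝ), Φ (Ψ z) = z)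

/-- Averaging an analytic function along a continuous family of contractions of the source
yields an analytic function. -/
theorem AnalyticAt.intervalIntegral_smul_comp_clm {E F : Type*}
    [NormedAddCommGroup E] [NormedSpace ℝ E] [NormedAddCommGroup F] [NormedSpace ℝ F]
    [CompleteSpace F] {g : E → F} (hg : AnalyticAt ℝ g 0) {L : ℝ → E →L[ℝ] E}
    (hL : Continuous L) (hL1 : ∀ t ∈ Set.Icc (0 : ℝ) 1, ‖L t‖ ≤ 1) {w : ℝ → ℝ}
    (hw : Continuous w) (hw1 : ∀ t ∈ Set.Icc (0 : ℝ) 1, |w t| ≤ 1) :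
    AnalyticAt ℝ (fun z => ∫ t in (0 : ℝ)..1, w t • g (L t z)) 0 := by
  obtain ⟨p, r, hp⟩ := hg
  let m : ∀ n, ℝ → ContinuousMultilinearMap ℝ (fun _ : Fin n => E) F :=
    fun n t => w t • (p n).compContinuousLinearMap (fun _ => L t)
  have hm_cont : ∀ n, Continuous (m n) := fun n => by
    refine hw.smul ?_
    have h : Continuous fun t =>
        ContinuousMultilinearMap.compContinuousLinearMapContinuousMultilinear ℝ
          (fun _ : Fin n => E) (fun _ : Fin n => E) F (fun _ => L t) (p n) :=
      ((ContinuousMultilinearMap.cont _).comp (continuous_pi fun _ => hL)).clm_apply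
        continuous_const
    exact h
  have hIoc : ∀ t ∈ Set.uIoc (0 : ℝ) 1, t ∈ Set.Icc (0 : ℝ) 1 := fun t ht => by
    rw [Set.uIoc_of_le zero_le_one] at ht
    exact Set.Ioc_subset_Icc_self ht
  have hm_norm : ∀ n, ∀ t ∈ Set.Icc (0 : ℝ) 1, ‖m n t‖ ≤ ‖p n‖ := fun n t ht => by
    have h1 : ‖(p n).compContinuousLinearMap (fun _ => L t)‖ ≤ ‖p n‖ := by
      refine (ContinuousMultilinearMap.norm_compContinuousLinearMap_le _ _).trans ?_
      refine mul_le_of_le_one_right (norm_nonneg _) ?_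
      exact Finset.prod_le_one (fun _ _ => norm_nonneg _) fun _ _ => hL1 t ht
    calc ‖m n t‖ = |w t| * ‖(p n).compContinuousLinearMap (fun _ => L t)‖ := by
          simp only [m, norm_smul, Real.norm_eq_abs]
      _ ≤ 1 * ‖p n‖ := mul_le_mul (hw1 t ht) h1 (norm_nonneg _) zero_le_one
      _ = ‖p n‖ := one_mul _
  let q : FormalMultilinearSeries ℝ E F := fun n => ∫ t in (0 : ℝ)..1, m n t
  have hq_norm : ∀ n, ‖q n‖ ≤ ‖p n‖ := fun n => by
    simpa using intervalIntegral.norm_integral_le_of_norm_le_const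
      fun t ht => hm_norm n t (hIoc t ht)
  have hq_apply : ∀ n v, q n v = ∫ t in (0 : ℝ)..1, w t • p n fun i => L t (v i) := fun n v => by
    have h := ContinuousMultilinearMap.integral_apply
      (((hm_cont n).intervalIntegrable (μ := MeasureTheory.volume) 0 1).1) v
    simp only [q, intervalIntegral.integral_of_le zero_le_one, h]
    rfl
  refine ⟨q, r, ?_, hp.r_pos, fun {y} hy => ?_⟩
  · refine ENNReal.le_of_forall_nnreal_lt fun s hs => ?_
    refine q.le_radius_of_summable ?_
    refine Summable.of_nonneg_of_le (fun n => by positivity) (fun n => ?_)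
      (p.summable_norm_mul_pow (hs.trans_le hp.r_le))
    gcongr
    exact hq_norm n
  · simp only [hq_apply, zero_add]
    have hy' : (‖y‖₊ : ENNReal) < r := by simpa [enorm_eq_nnnorm] using hy
    have hsum := p.summable_norm_mul_pow (hy'.trans_le hp.r_le)
    refine intervalIntegral.hasSum_integral_of_dominated_convergence
      (fun n _ => ‖p n‖ * (‖y‖₊ : ℝ) ^ n) (fun n => ?_) (fun n => ?_) ?_ ?_ ?_
    · have h : Continuous fun t => m n t (fun _ => y) :=
        (ContinuousMultilinearMap.apply ℝ (fun _ : Fin n => E) F (fun _ => y)).continuous.comp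
          (hm_cont n)
      exact h.aestronglyMeasurable
    · refine .of_forall fun t ht => ?_
      refine ((m n t).le_opNorm (fun _ => y)).trans ?_
      simp only [Finset.prod_const, Finset.card_univ, Fintype.card_fin, coe_nnnorm]
      gcongr
      exact hm_norm n t (hIoc t ht)
    · exact .of_forall fun _ _ => hsum
    · exact intervalIntegrable_const
    · refine .of_forall fun t ht => ?_
      have hLy : L t y ∈ Metric.eball (0 : E) r := by
        have h1 : ‖L t y‖ ≤ ‖y‖ := by
          simpa using (L t).le_of_opNorm_le (hL1 t (hIoc t ht)) y
        have h2 : ‖L t y‖₊ ≤ ‖y‖₊ := h1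
        simpa [enorm_eq_nnnorm] using (ENNReal.coe_le_coe.2 h2).trans_lt hy'
      simpa using (hp.hasSum hLy).const_smul (w t)

theorem jacDet_eq_det {Φ : ℝ × ℝ → ℝ × ℝ} {z : ℝ × ℝ} (h : DifferentiableAt ℝ Φ z) :
    jacDet Φ z = (fderiv ℝ Φ z).det := by
  have h1 : fderiv ℝ (fun w => (Φ w).1) z = (ContinuousLinearMap.fst ℝ ℝ ℝ).comp (fderiv ℝ Φ z) :=
    h.hasFDerivAt.fst.fderiv
  have h2 : fderiv ℝ (fun w => (Φ w).2) z = (ContinuousLinearMap.snd ℝ ℝ ℝ).comp (fderiv ℝ Φ z) :=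
    h.hasFDerivAt.snd.fderiv
  rw [ContinuousLinearMap.det, ← LinearMap.det_toMatrix (Module.Basis.finTwoProd ℝ),
    Matrix.det_fin_two]
  simp [jacDet, pdx, pdy, h1, h2, LinearMap.toMatrix_apply]

theorem jacDet_comp {Φ Ψ : ℝ × ℝ → ℝ × ℝ} {z : ℝ × ℝ} (hΦ : DifferentiableAt ℝ Φ (Ψ z))
    (hΨ : DifferentiableAt ℝ Ψ z) :
    jacDet (Φ ∘ Ψ) z = jacDet Φ (Ψ z) * jacDet Ψ z := by
  rw [jacDet_eq_det (hΦ.comp z hΨ), jacDet_eq_det hΦ, jacDet_eq_det hΨ, fderiv_comp z hΦ hΨ]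
  simp [ContinuousLinearMap.det]

theorem jacDet_congr {Φ Ψ : ℝ × ℝ → ℝ × ℝ} {z : ℝ × ℝ} (h : Φ =ᶠ[𝓝 z] Ψ) :
    jacDet Φ z = jacDet Ψ z := by
  have h1 : fderiv ℝ (fun w => (Φ w).1) z = fderiv ℝ (fun w => (Ψ w).1) z :=
    (h.fun_comp Prod.fst).fderiv_eq
  have h2 : fderiv ℝ (fun w => (Φ w).2) z = fderiv ℝ (fun w => (Ψ w).2) z :=
    (h.fun_comp Prod.snd).fderiv_eq
  simp only [jacDet, pdx, pdy, h1, h2]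

theorem jacDet_id (z : ℝ × ℝ) : jacDet id z = 1 := by
  rw [jacDet_eq_det differentiableAt_id]
  simp [ContinuousLinearMap.det]

theorem analyticAt_jacDet {Φ : ℝ × ℝ → ℝ × ℝ} {z : ℝ × ℝ} (h : AnalyticAt ℝ Φ z) :
    AnalyticAt ℝ (jacDet Φ) z := by
  have h1 : AnalyticAt ℝ (fun w => (Φ w).1) z := analyticAt_fst.comp h
  have h2 : AnalyticAt ℝ (fun w => (Φ w).2) z := analyticAt_snd.comp h
  have hd : ∀ {g : ℝ × ℝ → ℝ}, AnalyticAt ℝ g z → ∀ v, AnalyticAt ℝ (fun w => fderiv ℝ g w v) z :=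
    fun hg v => ((ContinuousLinearMap.apply ℝ ℝ v).analyticAt _).comp hg.fderiv
  exact ((hd h1 _).mul (hd h2 _)).sub ((hd h1 _).mul (hd h2 _))

/-- The analytic inverse function theorem in the plane. -/
theorem isAnalyticDiffeoGermAtZero_of_jacDet_ne_zero {Φ : ℝ × ℝ → ℝ × ℝ}
    (hΦ : AnalyticAt ℝ Φ 0) (hΦ0 : Φ 0 = 0) (hdet : jacDet Φ 0 ≠ 0) :
    IsAnalyticDiffeoGermAtZero Φ := by
  rw [jacDet_eq_det hΦ.differentiableAt] at hdet
  have hcd : ContDiffAt ℝ ⊤ Φ 0 := hΦ.contDiffAt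
  have hd : HasFDerivAt Φ
      ((fderiv ℝ Φ 0).toContinuousLinearEquivOfDetNeZero hdet : ℝ × ℝ →L[ℝ] ℝ × ℝ) 0 := by
    simpa using hΦ.differentiableAt.hasFDerivAt
  have hs := hcd.hasStrictFDerivAt' hd (by simp)
  refine ⟨hΦ, hΦ0, hcd.localInverse hd (by simp), ?_, ?_, ?_, ?_⟩
  · have h := hcd.to_localInverse hd (by simp)
    rw [hΦ0] at h
    exact h.analyticAt
  · simpa only [hΦ0] using hcd.localInverse_apply_image hd (by simp)
  · exact hs.eventually_left_inverse
  · have h := hs.eventually_right_inverse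
    rw [hΦ0] at h
    exact h

theorem IsAnalyticDiffeoGermAtZero.comp {Φ Ψ : ℝ × ℝ → ℝ × ℝ}
    (hΦ : IsAnalyticDiffeoGermAtZero Φ) (hΨ : IsAnalyticDiffeoGermAtZero Ψ) :
    IsAnalyticDiffeoGermAtZero (Φ ∘ Ψ) := by
  obtain ⟨ha, h0, Φ', ha', h0', hl, hr⟩ := hΦ
  obtain ⟨ka, k0, Ψ', ka', k0', kl, kr⟩ := hΨ
  refine ⟨ha.comp_of_eq ka k0, by simp [h0, k0], Ψ' ∘ Φ', ka'.comp_of_eq ha' h0',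
    by simp [h0', k0'], ?_, ?_⟩
  · have ht : Tendsto Ψ (𝓝 0) (𝓝 0) := by simpa [k0] using ka.continuousAt.tendsto
    filter_upwards [kl, ht.eventually hl] with z h1 h2
    simp [h2, h1]
  · have ht : Tendsto Φ' (𝓝 0) (𝓝 0) := by simpa [h0'] using ha'.continuousAt.tendsto
    filter_upwards [hr, ht.eventually kr] with z h1 h2
    simp [h2, h1]

/-- A square root of the primitive of `2 x g` in the first variable. -/
theorem exists_analyticAt_mul_pdx_eq {g : ℝ × ℝ → ℝ} (hg : AnalyticAt ℝ g 0) (hg0 : 0 < g 0) :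
    ∃ X : ℝ × ℝ → ℝ, AnalyticAt ℝ X 0 ∧ X 0 = 0 ∧ pdx X 0 ≠ 0 ∧
      ∀ᶠ z in 𝓝 (0 : ℝ × ℝ), X z * pdx X z = z.1 * g z := by
  let L : ℝ → ℝ × ℝ →L[ℝ] ℝ × ℝ := fun t =>
    t • (ContinuousLinearMap.inl ℝ ℝ ℝ).comp (ContinuousLinearMap.fst ℝ ℝ ℝ) +
      (ContinuousLinearMap.inr ℝ ℝ ℝ).comp (ContinuousLinearMap.snd ℝ ℝ ℝ)
  have hL_apply : ∀ t z, L t z = (t * z.1, z.2) := fun t z => by simp [L]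
  let B : ℝ × ℝ → ℝ := fun z => ∫ t in (0 : ℝ)..1, t • g (L t z)
  have hB : AnalyticAt ℝ B 0 := by
    refine hg.intervalIntegral_smul_comp_clm (by fun_prop) (fun t ht => ?_) continuous_id
      (fun t ht => abs_le.2 ⟨by linarith [ht.1], ht.2⟩)
    refine ContinuousLinearMap.opNorm_le_bound _ zero_le_one fun z => ?_
    rw [hL_apply, one_mul, Prod.norm_def, Prod.norm_def, norm_mul, Real.norm_of_nonneg ht.1]
    exact max_le_max (mul_le_of_le_one_left (norm_nonneg _) ht.2) le_rfl
  have hB0 : B 0 = g 0 / 2 := by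
    simp [B, intervalIntegral.integral_mul_const, integral_id]
    ring
  have hB0' : 0 < B 0 := by rw [hB0]; positivity
  let s : ℝ × ℝ → ℝ := fun z => √(2 * B z)
  have hs : AnalyticAt ℝ s 0 := by
    have h : AnalyticAt ℝ (fun z => 2 * B z) 0 := analyticAt_const.mul hB
    exact (h.contDiffAt.sqrt (by positivity)).analyticAt
  let X : ℝ × ℝ → ℝ := fun z => z.1 * s z
  have hX : AnalyticAt ℝ X 0 := analyticAt_fst.mul hs
  refine ⟨X, hX, by simp [X], ?_, ?_⟩
  · have h : HasFDerivAt X _ 0 := hasFDerivAt_fst.mul hs.differentiableAt.hasFDerivAt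
    rw [pdx, h.fderiv]
    have : s 0 ≠ 0 := (Real.sqrt_pos.2 (by positivity)).ne'
    simpa using this
  · have hBpos : ∀ᶠ z in 𝓝 (0 : ℝ × ℝ), 0 < B z := hB.continuousAt.eventually_const_lt hB0'
    obtain ⟨r, hr, hball⟩ := Metric.eventually_nhds_iff_ball.1
      (hg.eventually_continuousAt.and (hBpos.and hX.eventually_analyticAt))
    filter_upwards [Metric.ball_mem_nhds _ hr] with z hz
    obtain ⟨u, v⟩ := z
    have hmem : ∀ {x : ℝ}, (x, v) ∈ Metric.ball (0 : ℝ × ℝ) r ↔ |x| < r ∧ |v| < r := by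
      intro x; simp [Prod.norm_def]
    have hv := (hmem.1 hz).2
    have hu := (hmem.1 hz).1
    have hcont : ContinuousOn (fun x => x * g (x, v)) (Set.Ioo (-r) r) := fun x hx => by
      have h := (hball (x, v) (hmem.2 ⟨abs_lt.2 hx, hv⟩)).1
      have h' : ContinuousAt (fun x => g (x, v)) x :=
        ContinuousAt.comp (f := fun x => (x, v)) h (by fun_prop)
      exact (continuousAt_id.mul h').continuousWithinAt
    have hsq : ∀ᶠ x in 𝓝 u, X (x, v) ^ 2 = 2 * ∫ t in (0 : ℝ)..x, t * g (t, v) := by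
      filter_upwards [isOpen_Ioo.mem_nhds (abs_lt.1 hu)] with x hx
      have hpos := (hball (x, v) (hmem.2 ⟨abs_lt.2 hx, hv⟩)).2.1
      have hsub : x * ∫ t in (0 : ℝ)..1, (x * t) * g (x * t, v) =
          ∫ t in (0 : ℝ)..x, t * g (t, v) := by
        simpa using intervalIntegral.mul_integral_comp_mul_left (a := 0) (b := 1)
          (f := fun t => t * g (t, v)) x
      have hBx : x * B (x, v) = ∫ t in (0 : ℝ)..1, (x * t) * g (x * t, v) := by
        simp only [B, hL_apply, smul_eq_mul]
        rw [← intervalIntegral.integral_const_mul]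
        congr 1
        ext t
        rw [mul_comm t x, mul_assoc]
      rw [← hsub, ← hBx]
      simp only [X, s, mul_pow]
      rw [Real.sq_sqrt (by positivity)]
      ring
    have hd1 : HasDerivAt (fun x => X (x, v)) (pdx X (u, v)) u := by
      have h := (hball (u, v) hz).2.2.differentiableAt.hasFDerivAt
      exact h.comp_hasDerivAt u ((hasDerivAt_id u).prodMk (hasDerivAt_const u v))
    have hu' := abs_lt.1 hu
    have hnhds : Set.Ioo (-r) r ∈ 𝓝 u := isOpen_Ioo.mem_nhds hu'
    have hd2 : HasDerivAt (fun x => ∫ t in (0 : ℝ)..x, t * g (t, v)) (u * g (u, v)) u := by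
      refine intervalIntegral.integral_hasDerivAt_right ?_
        (hcont.stronglyMeasurableAtFilter isOpen_Ioo u hu') (hcont.continuousAt hnhds)
      refine (hcont.mono ?_).intervalIntegrable
      exact Set.OrdConnected.uIcc_subset Set.ordConnected_Ioo ⟨by linarith, hr⟩ hu'
    have huniq := ((hd2.const_mul 2).congr_of_eventuallyEq hsq).unique (hd1.pow 2)
    simp at huniq ⊢
    linarith

/-- Normal form at a regular transversal point of the Martinet curve: if
`ω = x·c(x,y) dx∧dy` is a Martinet germ (`c(0) ≠ 0`) and `f` is regular along the
Martinet curve (`f(0) = 0`, `∂f/∂y(0) ≠ 0`), then some analytic diffeomorphism germ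
`Φ` pulls `ω` back to `x dx∧dy` and `f` back to `± y`. -/
theorem normal_form_regular_transversal (c f : ℝ × ℝ → ℝ)
    (hc : AnalyticAt ℝ c 0) (hc0 : c 0 ≠ 0)
    (hf : AnalyticAt ℝ f 0) (hf0 : f 0 = 0) (hfy : pdy f 0 ≠ 0) :
    ∃ ε : ℝ, (ε = 1 ∨ ε = -1) ∧
      ∃ Φ : ℝ × ℝ → ℝ × ℝ, IsAnalyticDiffeoGermAtZero Φ ∧
        ∀ᶠ z in 𝓝 (0 : ℝ × ℝ),
          (Φ z).1 * c (Φ z) * jacDet Φ z = z.1 ∧ f (Φ z) = ε * z.2 := by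
  have hG : IsAnalyticDiffeoGermAtZero fun z => (z.1, f z) := by
    refine isAnalyticDiffeoGermAtZero_of_jacDet_ne_zero (analyticAt_fst.prod hf) (by simp [hf0]) ?_
    simpa [jacDet, pdx, pdy, fderiv_fst] using hfy
  obtain ⟨hGa, hG0, A, hA, hA0, hAG, hGA⟩ := hG
  have hA_germ : IsAnalyticDiffeoGermAtZero A := ⟨hA, hA0, _, hGa, hG0, hGA, hAG⟩
  have hjacA : jacDet A 0 ≠ 0 := by
    intro h
    have hcomp := jacDet_comp (z := 0) (Φ := fun z => (z.1, f z)) (Ψ := A)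
      (by rw [hA0]; exact hGa.differentiableAt) hA.differentiableAt
    rw [h, mul_zero] at hcomp
    exact one_ne_zero ((jacDet_id 0).symm.trans ((jacDet_congr hGA).symm.trans hcomp))
  have hcA : AnalyticAt ℝ (fun z => c (A z) * jacDet A z) 0 := by
    have h : AnalyticAt ℝ (c ∘ A) 0 := hc.comp_of_eq hA hA0
    exact h.mul (analyticAt_jacDet hA)
  have hcA0 : c (A 0) * jacDet A 0 ≠ 0 := by
    rw [hA0]
    exact mul_ne_zero hc0 hjacA
  obtain ⟨σ, hσ, hσpos⟩ : ∃ σ : ℝ, (σ = 1 ∨ σ = -1) ∧ 0 < σ * (c (A 0) * jacDet A 0) := by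
    rcases hcA0.lt_or_gt with h | h
    · exact ⟨-1, .inr rfl, by linarith⟩
    · exact ⟨1, .inl rfl, by linarith⟩
  have hσσ : σ * σ = 1 := by rcases hσ with rfl | rfl <;> norm_num
  obtain ⟨X, hX, hX0, hXx, hXeq⟩ :=
    exists_analyticAt_mul_pdx_eq (g := fun z => σ * (c (A z) * jacDet A z))
      (analyticAt_const.mul hcA) hσpos
  have hjacH : ∀ z, jacDet (fun z => (X z, σ * z.2)) z = pdx X z * σ := fun z => by
    have h : fderiv ℝ (fun w : ℝ × ℝ => σ * w.2) z = σ • ContinuousLinearMap.snd ℝ ℝ ℝ :=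
      (hasFDerivAt_snd.const_mul σ).fderiv
    simp [jacDet, pdx, pdy, h]
  have hH : IsAnalyticDiffeoGermAtZero fun z => (X z, σ * z.2) := by
    refine isAnalyticDiffeoGermAtZero_of_jacDet_ne_zero
      (hX.prod (analyticAt_const.mul analyticAt_snd)) (by simp [hX0]) ?_
    rw [hjacH]
    exact mul_ne_zero hXx (left_ne_zero_of_mul_eq_one hσσ)
  obtain ⟨hHa, hH0, K, hK, hK0, hKH, hHK⟩ := hH
  have hK_germ : IsAnalyticDiffeoGermAtZero K := ⟨hK, hK0, _, hHa, hH0, hHK, hKH⟩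
  refine ⟨σ, hσ, A ∘ K, hA_germ.comp hK_germ, ?_⟩
  have hKt : Tendsto K (𝓝 0) (𝓝 0) := by simpa [hK0] using hK.continuousAt.tendsto
  filter_upwards [hHK.eventually_nhds, hK.eventually_analyticAt, hKt.eventually hGA,
    hKt.eventually hXeq, hKt.eventually hA.eventually_analyticAt,
    hKt.eventually hHa.eventually_analyticAt] with z hHKz hKz hGAz hXz hAz hHz
  have h1 : (A (K z)).1 = (K z).1 := (congrArg Prod.fst hGAz :)
  have h2 : f (A (K z)) = (K z).2 := congrArg Prod.snd hGAz
  have h3 : X (K z) = z.1 := congrArg Prod.fst hHKz.self_of_nhds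
  have h4 : σ * (K z).2 = z.2 := congrArg Prod.snd hHKz.self_of_nhds
  have hHKjac : pdx X (K z) * σ * jacDet K z = 1 := by
    rw [← hjacH, ← jacDet_comp hHz.differentiableAt hKz.differentiableAt]
    exact (jacDet_congr hHKz).trans (jacDet_id z)
  refine ⟨?_, ?_⟩
  · rw [jacDet_comp hAz.differentiableAt hKz.differentiableAt]
    simp only [Function.comp_apply, h1]
    calc (K z).1 * c (A (K z)) * (jacDet A (K z) * jacDet K z)
        = (σ * σ) * ((K z).1 * (c (A (K z)) * jacDet A (K z))) * jacDet K z := by rw [hσσ]; ring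
      _ = σ * (X (K z) * pdx X (K z)) * jacDet K z := by rw [hXz]; ring
      _ = X (K z) * (pdx X (K z) * σ * jacDet K z) := by ring
      _ = z.1 := by rw [hHKjac, h3, mul_one]
  · simp only [Function.comp_apply, h2, ← h4]
    rw [← mul_assoc, hσσ, one_mul]
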